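/- For any real numbers γ_1,…,γ_n there exists a constant C < ∞ such that every exponential polynomial q(s) = Σ_{k=1}^{n} a_k e^{iγ_k s}, a_k ∈ ℂ, of a complex variable s that is not identically zero has at most C zeros (counted with multiplicity) in the segment [−1, 1]. -/

import Mathlib

open Filter Metric

/-- An entire function vanishing on a ball around the origin is zero. -/
lemma Differentiable.eq_zero_of_eq_zero_on_closedBall {f : ℂ → ℂ} (hf : Differentiable ℂ f)
    {r : ℝ} (hr : 0 < r) (h : ∀ w ∈ closedBall (0 : ℂ) r, f w = 0) : f = 0 := by
  have hf' : AnalyticOnNhd ℂ f Set.univ := fun z _ => hf.analyticAt z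
  refine hf'.eq_of_eventuallyEq (z₀ := 0) (fun z _ => analyticAt_const) ?_
  filter_upwards [closedBall_mem_nhds (0 : ℂ) hr] with w hw using h w hw

/-- In a finite-dimensional space of entire functions, the supremum over a disc is controlled by
the supremum over any other disc centred at the origin. -/
lemma exists_norm_le_mul_of_finiteDimensional {E : Type*} [AddCommGroup E] [Module ℂ E]
    [FiniteDimensional ℂ E] (Φ : E →ₗ[ℂ] (ℂ → ℂ)) (hΦ : ∀ a, Differentiable ℂ (Φ a))
    {r : ℝ} (hr : 0 < r) (R : ℝ) :
    ∃ K : ℝ, ∀ a M, (∀ w ∈ closedBall (0 : ℂ) r, ‖Φ a w‖ ≤ M) →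
      ∀ w ∈ closedBall (0 : ℂ) R, ‖Φ a w‖ ≤ K * M := by
  let T (ρ : ℝ) : E →ₗ[ℂ] C(closedBall (0 : ℂ) ρ, ℂ) :=
    { toFun := fun a => ⟨fun w => Φ a w, (hΦ a).continuous.comp continuous_subtype_val⟩
      map_add' := fun a b => by ext; simp
      map_smul' := fun c a => by ext; simp }
  obtain ⟨g, hg⟩ := (T r).rangeRestrict.exists_rightInverse_of_surjective
    (LinearMap.range_rangeRestrict _)
  let S : LinearMap.range (T r) →L[ℂ] C(closedBall (0 : ℂ) R, ℂ) :=
    LinearMap.toContinuousLinearMap (T R ∘ₗ g)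
  refine ⟨‖S‖, fun a M hM w hw => ?_⟩
  have hM0 : 0 ≤ M := (norm_nonneg _).trans (hM 0 (mem_closedBall_self hr.le))
  have hker : Φ (g ((T r).rangeRestrict a)) = Φ a := by
    have h1 : T r (g ((T r).rangeRestrict a)) = T r a :=
      congrArg Subtype.val (LinearMap.congr_fun hg ((T r).rangeRestrict a))
    have h2 := (hΦ (g ((T r).rangeRestrict a) - a)).eq_zero_of_eq_zero_on_closedBall hr
      fun w hw => by
        have h3 : Φ (g ((T r).rangeRestrict a)) w = Φ a w := DFunLike.congr_fun h1 ⟨w, hw⟩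
        simp [map_sub, h3]
    rwa [map_sub, sub_eq_zero] at h2
  have hT : ‖(T r).rangeRestrict a‖ ≤ M :=
    (ContinuousMap.norm_le _ hM0).2 fun w => hM w w.2
  calc ‖Φ a w‖ = ‖S ((T r).rangeRestrict a) ⟨w, hw⟩‖ := by
        change _ = ‖Φ (g ((T r).rangeRestrict a)) w‖
        rw [hker]
    _ ≤ ‖S ((T r).rangeRestrict a)‖ := ContinuousMap.norm_coe_le_norm _ _
    _ ≤ ‖S‖ * M := S.le_opNorm_of_le hT

/-- A local factor `(w - z) ^ m` of an entire function splits off globally. -/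
lemma Differentiable.exists_eq_sub_pow_mul {f : ℂ → ℂ} (hf : Differentiable ℂ f) {z : ℂ} {m : ℕ}
    {g : ℂ → ℂ} (hg : AnalyticAt ℂ g z) (hfg : ∀ᶠ w in nhds z, f w = (w - z) ^ m * g w) :
    ∃ h : ℂ → ℂ, Differentiable ℂ h ∧ ∀ w, f w = (w - z) ^ m * h w := by
  classical
  let h := Function.update (fun w => f w / (w - z) ^ m) z (g z)
  have hne : ∀ w, w ≠ z → h w = f w / (w - z) ^ m := fun w hw => Function.update_of_ne hw _ _
  refine ⟨h, fun w => ?_, fun w => ?_⟩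
  · rcases eq_or_ne w z with rfl | hw
    · refine hg.differentiableAt.congr_of_eventuallyEq ?_
      filter_upwards [hfg] with v hv
      rcases eq_or_ne v w with rfl | hvw
      · exact Function.update_self _ _ _
      · rw [hne v hvw, hv, mul_div_cancel_left₀ _ (pow_ne_zero _ (sub_ne_zero.2 hvw))]
    · have hd : DifferentiableAt ℂ (fun w => f w / (w - z) ^ m) w :=
        (hf w).div (by fun_prop) (pow_ne_zero _ (sub_ne_zero.2 hw))
      refine hd.congr_of_eventuallyEq ?_
      filter_upwards [isOpen_ne.mem_nhds hw] with v hv using hne v hv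
  · rcases eq_or_ne w z with rfl | hw
    · simpa [h] using hfg.self_of_nhds
    · rw [hne w hw, mul_div_cancel₀ _ (pow_ne_zero _ (sub_ne_zero.2 hw))]

/-- Finitely many local factors of an entire function split off globally. -/
lemma Differentiable.exists_eq_prod_sub_pow_mul (Z : Finset ℂ) (m : ℂ → ℕ) {f : ℂ → ℂ}
    (hf : Differentiable ℂ f)
    (hZ : ∀ z ∈ Z, ∃ g : ℂ → ℂ, AnalyticAt ℂ g z ∧
      ∀ᶠ w in nhds z, f w = (w - z) ^ m z * g w) :
    ∃ h : ℂ → ℂ, Differentiable ℂ h ∧ ∀ w, f w = (∏ z ∈ Z, (w - z) ^ m z) * h w := by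
  induction Z using Finset.induction_on generalizing f with
  | empty => exact ⟨f, hf, by simp⟩
  | insert z Z hz ih =>
    obtain ⟨g, hg, hfg⟩ := hZ z (Finset.mem_insert_self z Z)
    obtain ⟨f₁, hf₁, hff₁⟩ := hf.exists_eq_sub_pow_mul hg hfg
    obtain ⟨h, hh, hfh⟩ := ih hf₁ fun z' hz' => by
      obtain ⟨g', hg', hfg'⟩ := hZ z' (Finset.mem_insert_of_mem hz')
      have hne : z' ≠ z := fun h => hz (h ▸ hz')
      refine ⟨fun w => g' w / (w - z) ^ m z, hg'.div (by fun_prop)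
        (pow_ne_zero _ (sub_ne_zero.2 hne)), ?_⟩
      filter_upwards [hfg', isOpen_ne.mem_nhds hne] with w hw hwz
      have hp : (w - z) ^ m z ≠ 0 := pow_ne_zero _ (sub_ne_zero.2 hwz)
      rw [hff₁] at hw
      rw [mul_div_assoc', eq_div_iff hp, ← hw, mul_comm]
    exact ⟨h, hh, fun w => by rw [hff₁, hfh, Finset.prod_insert hz, mul_assoc]⟩

/-- An entire function bounded by `B` on the circle of radius `5` and divisible by
`∏ (w - z) ^ m z`, where all `z` lie in the unit disc, is small on the unit disc. -/
lemma Differentiable.norm_le_of_eq_prod_sub_pow_mul {Z : Finset ℂ} {m : ℂ → ℕ} {f h : ℂ → ℂ}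
    (hh : Differentiable ℂ h) (hZ : ∀ z ∈ Z, ‖z‖ ≤ 1)
    (hfh : ∀ w, f w = (∏ z ∈ Z, (w - z) ^ m z) * h w) {B : ℝ}
    (hB : ∀ w ∈ sphere (0 : ℂ) 5, ‖f w‖ ≤ B) {w : ℂ} (hw : ‖w‖ ≤ 1) :
    2 ^ (∑ z ∈ Z, m z) * ‖f w‖ ≤ B := by
  have hnorm : ∀ v, ‖f v‖ = (∏ z ∈ Z, ‖v - z‖ ^ m z) * ‖h v‖ := fun v => by
    rw [hfh, norm_mul, norm_prod]; simp only [norm_pow]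
  have hsphere : ∀ v ∈ frontier (ball (0 : ℂ) 5), ‖h v‖ ≤ B / 4 ^ (∑ z ∈ Z, m z) := by
    intro v hv
    rw [frontier_ball _ (by norm_num)] at hv
    have hprod : (4 : ℝ) ^ (∑ z ∈ Z, m z) ≤ ∏ z ∈ Z, ‖v - z‖ ^ m z := by
      rw [← Finset.prod_pow_eq_pow_sum]
      refine Finset.prod_le_prod (fun _ _ => by positivity) fun z hz => ?_
      have h5 : ‖v‖ = 5 := by simpa using hv
      have := norm_sub_norm_le v z
      have := hZ z hz
      gcongr
      linarith
    rw [le_div_iff₀' (by positivity)]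
    exact (mul_le_mul_of_nonneg_right hprod (norm_nonneg _)).trans (hnorm v ▸ hB v hv)
  have hhw : ‖h w‖ ≤ B / 4 ^ (∑ z ∈ Z, m z) :=
    Complex.norm_le_of_forall_mem_frontier_norm_le isBounded_ball hh.diffContOnCl hsphere
      (subset_closure (by simpa using hw.trans_lt (by norm_num)))
  have hprod : ∏ z ∈ Z, ‖w - z‖ ^ m z ≤ (2 : ℝ) ^ (∑ z ∈ Z, m z) := by
    rw [← Finset.prod_pow_eq_pow_sum]
    refine Finset.prod_le_prod (fun _ _ => by positivity) fun z hz => ?_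
    have := norm_sub_le w z
    have := hZ z hz
    gcongr
    linarith
  rw [le_div_iff₀' (by positivity)] at hhw
  calc 2 ^ (∑ z ∈ Z, m z) * ‖f w‖
      ≤ 2 ^ (∑ z ∈ Z, m z) * (2 ^ (∑ z ∈ Z, m z) * ‖h w‖) := by rw [hnorm]; gcongr
    _ = 4 ^ (∑ z ∈ Z, m z) * ‖h w‖ := by rw [← mul_assoc, ← mul_pow]; norm_num
    _ ≤ B := hhw

/-- for any real `γ_1, …, γ_n` there is a constant `C` such that every
exponential polynomial `q(s) = Σ_k a_k e^{i γ_k s}` which is not identically zero has at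
most `C` zeros, counted with multiplicity, on the segment `[-1, 1]` of the real axis.
A zero of `q` at `z` of multiplicity `m z` is witnessed by a local factorization
`q(w) = (w - z)^{m z} g(w)` with `g` analytic and non-vanishing at `z`. -/
theorem exp_poly_zero_count_bound (n : ℕ) (γ : Fin n → ℝ) :
    ∃ C : ℕ, ∀ a : Fin n → ℂ,
      (∃ s : ℂ, ∑ k, a k * Complex.exp (Complex.I * (γ k : ℂ) * s) ≠ 0) →
      ∀ (Z : Finset ℂ) (m : ℂ → ℕ),
        (∀ z ∈ Z, z.im = 0 ∧ -1 ≤ z.re ∧ z.re ≤ 1 ∧ 1 ≤ m z ∧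
          ∃ g : ℂ → ℂ, AnalyticAt ℂ g z ∧ g z ≠ 0 ∧
            ∀ᶠ w in nhds z,
              (∑ k, a k * Complex.exp (Complex.I * (γ k : ℂ) * w)) = (w - z) ^ m z * g w) →
        ∑ z ∈ Z, m z ≤ C := by
  let Φ : (Fin n → ℂ) →ₗ[ℂ] (ℂ → ℂ) :=
    { toFun := fun a s => ∑ k, a k * Complex.exp (Complex.I * (γ k : ℂ) * s)
      map_add' := fun a b => by ext; simp [add_mul, Finset.sum_add_distrib]
      map_smul' := fun c a => by ext; simp [Finset.mul_sum, mul_assoc] }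
  have hΦ : ∀ a, Differentiable ℂ (Φ a) := fun a => by
    change Differentiable ℂ fun s => ∑ k, a k * Complex.exp (Complex.I * (γ k : ℂ) * s)
    fun_prop
  obtain ⟨K, hK⟩ := exists_norm_le_mul_of_finiteDimensional Φ hΦ one_pos 5
  refine ⟨⌈K⌉₊, fun a ⟨s, hs⟩ Z m hZ => ?_⟩
  obtain ⟨w, hw, hmax⟩ := (isCompact_closedBall (0 : ℂ) 1).exists_isMaxOn
    ⟨0, mem_closedBall_self zero_le_one⟩ (hΦ a).continuous.norm.continuousOn
  have hpos : 0 < ‖Φ a w‖ := by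
    refine (norm_nonneg _).lt_of_ne fun h0 => hs ?_
    refine congrFun ((hΦ a).eq_zero_of_eq_zero_on_closedBall one_pos fun v hv => ?_) s
    exact norm_le_zero_iff.1 (h0 ▸ hmax hv)
  obtain ⟨h, hh, hfh⟩ := (hΦ a).exists_eq_prod_sub_pow_mul Z m fun z hz => by
    obtain ⟨-, -, -, -, g, hg, -, hfg⟩ := hZ z hz
    exact ⟨g, hg, hfg⟩
  have hZ1 : ∀ z ∈ Z, ‖z‖ ≤ 1 := fun z hz => by
    obtain ⟨him, hl, hu, -⟩ := hZ z hz
    rw [← Complex.abs_re_eq_norm.2 him]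
    exact abs_le.2 ⟨hl, hu⟩
  have hle := hh.norm_le_of_eq_prod_sub_pow_mul hZ1 hfh
    (fun v hv => hK a _ (fun v hv => hmax hv) v (sphere_subset_closedBall hv))
    (mem_closedBall_zero_iff.1 hw)
  have hpow : (2 : ℝ) ^ (∑ z ∈ Z, m z) ≤ K := le_of_mul_le_mul_right hle hpos
  have hlt : ((∑ z ∈ Z, m z : ℕ) : ℝ) ≤ 2 ^ (∑ z ∈ Z, m z) :=
    mod_cast (Nat.lt_two_pow_self (n := ∑ z ∈ Z, m z)).le
  exact Nat.cast_le.1 ((hlt.trans hpow).trans (Nat.le_ceil K))
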